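/- Let n ≥ 1, r > 0, and let f : [a, b] → ℝⁿ (a < b) be a continuous map with f(b) = −f(a) and ‖f(s)‖ > r for every s ∈ [a, b]. Then the length of f (the total variation of f on [a, b]) is strictly greater than π·r. -/

import Mathlib

open InnerProductGeometry in
theorem two_mul_mul_sin_half_angle_le_norm_sub {V : Type*} [NormedAddCommGroup V]
    [InnerProductSpace ℝ V] {x y : V} {m : ℝ} (hm : 0 ≤ m) (hx : m ≤ ‖x‖) (hy : m ≤ ‖y‖) :
    2 * m * Real.sin (angle x y / 2) ≤ ‖x - y‖ := by
  refine le_of_sq_le_sq ?_ (norm_nonneg _)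
  have hcos : Real.cos (angle x y) = 1 - 2 * Real.sin (angle x y / 2) ^ 2 := by
    have hdouble := Real.cos_two_mul (angle x y / 2)
    rw [mul_div_cancel₀ _ two_ne_zero, Real.cos_sq'] at hdouble
    linarith
  have hmul : m * m ≤ ‖x‖ * ‖y‖ := mul_le_mul hx hy hm (norm_nonneg x)
  rw [norm_sub_sq_real, ← cos_angle_mul_norm_mul_norm, hcos]
  nlinarith [sq_nonneg (‖x‖ - ‖y‖),
    mul_le_mul_of_nonneg_right hmul (sq_nonneg (Real.sin (angle x y / 2)))]

open InnerProductGeometry in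
theorem exists_pos_forall_mul_angle_le_norm_sub (V : Type*) [NormedAddCommGroup V]
    [InnerProductSpace ℝ V] {q m : ℝ} (hq : 0 < q) (hqm : q < m) :
    ∃ ε > 0, ∀ x y : V, m ≤ ‖x‖ → m ≤ ‖y‖ → ‖x - y‖ < ε → q * angle x y ≤ ‖x - y‖ := by
  have hm : 0 < m := hq.trans hqm
  set h : ℝ := 1 - q / m with hh
  have hqm' : q = m * (1 - h) := by rw [hh]; field_simp; ring
  have h0 : 0 < h := by rw [hh, sub_pos, div_lt_one hm]; exact hqm
  have h1 : h < 1 := by rw [hh, sub_lt_self_iff]; positivity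
  refine ⟨2 * m * (h / Real.pi), by positivity, fun x y hx hy hxy => ?_⟩
  have hsin := two_mul_mul_sin_half_angle_le_norm_sub hm.le hx hy
  rcases (angle_nonneg x y).eq_or_lt with hθ | hθ
  · rw [← hθ, mul_zero]
    exact norm_nonneg _
  have hjordan : 2 / Real.pi * (angle x y / 2) ≤ Real.sin (angle x y / 2) :=
    Real.mul_le_sin (by linarith) (by linarith [angle_le_pi x y])
  have hsmall : angle x y ≤ h := by
    have hlt : Real.sin (angle x y / 2) < h / Real.pi :=
      lt_of_mul_lt_mul_left (hsin.trans_lt hxy) (by positivity)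
    have hdiv : angle x y / Real.pi < h / Real.pi := by
      refine lt_of_eq_of_lt ?_ (hjordan.trans_lt hlt)
      ring
    exact ((div_lt_div_iff_of_pos_right Real.pi_pos).1 hdiv).le
  refine le_trans ?_ hsin
  have hcube := Real.sin_gt_sub_cube (x := angle x y / 2) (by linarith)
  have hsq : angle x y ^ 2 ≤ 16 * h := by nlinarith
  have hbound : angle x y / 2 * (1 - h) ≤ Real.sin (angle x y / 2) := by
    nlinarith [mul_le_mul_of_nonneg_left hsq hθ.le]
  calc q * angle x y = 2 * m * (angle x y / 2 * (1 - h)) := by rw [hqm']; ring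
    _ ≤ 2 * m * Real.sin (angle x y / 2) := by gcongr

open InnerProductGeometry in
theorem angle_le_sum_range_angle {V : Type*} [NormedAddCommGroup V] [InnerProductSpace ℝ V]
    (u : ℕ → V) (h0 : u 0 ≠ 0) (N : ℕ) :
    angle (u 0) (u N) ≤ ∑ i ∈ Finset.range N, angle (u i) (u (i + 1)) := by
  induction N with
  | zero => simp [angle_self h0]
  | succ N ih =>
    rw [Finset.sum_range_succ]
    exact (angle_le_angle_add_angle _ (u N) _).trans (by gcongr)

open InnerProductGeometry in
theorem ofReal_mul_angle_le_eVariationOn {V : Type*} [NormedAddCommGroup V]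
    [InnerProductSpace ℝ V] {a b q m : ℝ} (hab : a ≤ b) {f : ℝ → V}
    (hf : ContinuousOn f (Set.Icc a b)) (hq : 0 < q) (hqm : q < m)
    (hm : ∀ s ∈ Set.Icc a b, m ≤ ‖f s‖) :
    ENNReal.ofReal (q * angle (f a) (f b)) ≤ eVariationOn f (Set.Icc a b) := by
  obtain ⟨ε, hε, hangle⟩ := exists_pos_forall_mul_angle_le_norm_sub V hq hqm
  obtain ⟨δ, hδ, hunif⟩ := Metric.uniformContinuousOn_iff.1
    (isCompact_Icc.uniformContinuousOn_of_continuous hf) ε hε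
  obtain ⟨N, hN⟩ := exists_nat_gt ((b - a) / δ)
  have hNpos : (0 : ℝ) < N := lt_of_le_of_lt (div_nonneg (sub_nonneg.2 hab) hδ.le) hN
  set t : ℕ → ℝ := fun i => a + i * ((b - a) / N) with ht
  have hstep : 0 ≤ (b - a) / N := div_nonneg (sub_nonneg.2 hab) hNpos.le
  have htmono : Monotone t := fun i j hij => by
    simp only [ht]
    gcongr
  have ht0 : t 0 = a := by simp [ht]
  have htN : t N = b := by
    simp only [ht]
    field_simp
    ring
  have hmem : ∀ i ≤ N, t i ∈ Set.Icc a b := fun i hi =>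
    ⟨ht0 ▸ htmono (Nat.zero_le i), htN ▸ htmono hi⟩
  have hfa : f (t 0) ≠ 0 := norm_pos_iff.1
    ((hq.trans hqm).trans_le (hm _ (hmem 0 (Nat.zero_le N))))
  have hsum : q * angle (f a) (f b) ≤
      ∑ i ∈ Finset.range N, dist (f (t (i + 1))) (f (t i)) := by
    rw [← ht0, ← htN]
    refine (mul_le_mul_of_nonneg_left
      (angle_le_sum_range_angle (fun i => f (t i)) hfa N) hq.le).trans ?_
    rw [Finset.mul_sum]
    refine Finset.sum_le_sum fun i hi => ?_
    have hi' : i < N := Finset.mem_range.1 hi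
    have hdist : dist (t i) (t (i + 1)) < δ := by
      have hsub : t i - t (i + 1) = -((b - a) / N) := by
        simp only [ht]
        push_cast
        ring
      rw [Real.dist_eq, hsub, abs_neg, abs_of_nonneg hstep, div_lt_iff₀ hNpos, mul_comm]
      exact (div_lt_iff₀ hδ).1 hN
    have hclose := hunif _ (hmem i hi'.le) _ (hmem (i + 1) hi') hdist
    rw [dist_comm, dist_eq_norm]
    rw [dist_eq_norm] at hclose
    exact hangle _ _ (hm _ (hmem i hi'.le)) (hm _ (hmem (i + 1) hi')) hclose
  calc ENNReal.ofReal (q * angle (f a) (f b))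
      ≤ ENNReal.ofReal (∑ i ∈ Finset.range N, dist (f (t (i + 1))) (f (t i))) :=
        ENNReal.ofReal_le_ofReal hsum
    _ = ∑ i ∈ Finset.range N, edist (f (t (i + 1))) (f (t i)) := by
        rw [ENNReal.ofReal_sum_of_nonneg fun _ _ => dist_nonneg]
        simp only [edist_dist]
    _ ≤ eVariationOn f (Set.Icc a b) :=
        eVariationOn.sum_le_of_monotoneOn_Iic (htmono.monotoneOn _) hmem

/-- A continuous path `f : [a,b] → ℝⁿ` joining a pair of antipodal points
(`f b = -f a`) that stays outside the closed ball of radius `r > 0` has length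
(total variation) strictly greater than `π·r`. -/
theorem length_gt_pi_r_of_antipodal_outside_ball (n : ℕ) (hn : 1 ≤ n) (r : ℝ) (hr : 0 < r)
    (a b : ℝ) (hab : a < b) (f : ℝ → EuclideanSpace ℝ (Fin n))
    (hcont : ContinuousOn f (Set.Icc a b))
    (hanti : f b = -f a)
    (hout : ∀ s ∈ Set.Icc a b, r < ‖f s‖) :
    ENNReal.ofReal (Real.pi * r) < eVariationOn f (Set.Icc a b) := by
  obtain ⟨s, hs, hmin⟩ := isCompact_Icc.exists_isMinOn (Set.nonempty_Icc.2 hab.le) hcont.norm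
  obtain ⟨q, hrq, hqs⟩ := exists_between (hout s hs)
  have hq : 0 < q := hr.trans hrq
  have hfa : f a ≠ 0 := norm_pos_iff.1 (hr.trans (hout a (Set.left_mem_Icc.2 hab.le)))
  have hle := ofReal_mul_angle_le_eVariationOn hab.le hcont hq hqs fun t ht => hmin ht
  rw [hanti, InnerProductGeometry.angle_self_neg_of_nonzero hfa] at hle
  refine lt_of_lt_of_le ?_ hle
  rw [ENNReal.ofReal_lt_ofReal_iff (by positivity), mul_comm]
  gcongr
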